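/- arXiv:2203.05905 — 3 statements merged into one kernel-verified Lean document; each statement's English description precedes it below -/
import Mathlib

section
/- Let P and Q be real Banach spaces, D ⊆ P a nonempty closed convex subset, and J : P → Q a map that is continuous on D and such that the closure of J(D) in Q is compact. Let F : P × Q → P be continuous on D × closure(J(D)) with F(x,y) ∈ D for every x ∈ D and y ∈ closure(J(D)), and suppose there is a constant k with 0 ≤ k < 1 such that for every y ∈ closure(J(D)) the map x ↦ F(x,y) is k-Lipschitz on D (i.e. ‖F(x₁,y) − F(x₂,y)‖ ≤ k‖x₁ − x₂‖ for all x₁, x₂ ∈ D). Then there exists z ∈ D such that F(z, J(z)) = z. -/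
section Scarf

variable {V ι α : Type*} [LinearOrder α]

/-- A set `U` is dominant for a family of rankings `r i` if no element of `V` is ranked strictly
above the minimum of `U` in all of the rankings. -/
def IsDominant (r : ι → V → α) (U : Finset V) : Prop :=
  ∀ v, ∃ i, ∀ u ∈ U, r i v ≤ r i u

theorem IsDominant.mono {r : ι → V → α} {U W : Finset V} (hW : IsDominant r W) (h : U ⊆ W) :
    IsDominant r U := fun v ↦ (hW v).imp fun _ hi u hu ↦ hi u (h hu)

theorem IsDominant.exists_min {r : ι → V → α} (hr : ∀ i, (r i).Injective) {U : Finset V}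
    (hU : IsDominant r U) (hne : U.Nonempty) :
    ∃ m : ι → V, (∀ i, m i ∈ U) ∧ (∀ i, ∀ u ∈ U, r i (m i) ≤ r i u) ∧ ∀ u ∈ U, ∃ i, m i = u := by
  choose m hmU hm using fun i ↦ U.exists_min_image (r i) hne
  refine ⟨m, hmU, hm, fun u hu ↦ ?_⟩
  obtain ⟨i, hi⟩ := hU u
  exact ⟨i, hr i ((hm i u hu).antisymm (hi _ (hmU i)))⟩

variable [Fintype ι]

open Classical in
/-- The dominant sets having as many elements as there are rankings. -/
noncomputable def dominantCells [Fintype V] (r : ι → V → α) : Finset (Finset V) :=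
  {W | W.card = Fintype.card ι ∧ IsDominant r W}

theorem mem_dominantCells [Fintype V] {r : ι → V → α} {W : Finset V} :
    W ∈ dominantCells r ↔ W.card = Fintype.card ι ∧ IsDominant r W := by
  simp [dominantCells]

variable [DecidableEq V]

theorem mem_dominantCells_filter_subset [Fintype V] {r : ι → V → α} {U W : Finset V}
    (hcard : U.card + 1 = Fintype.card ι) :
    W ∈ {W ∈ dominantCells r | U ⊆ W} ↔
      ∃ v, (v ∉ U ∧ IsDominant r (insert v U)) ∧ insert v U = W := by
  rw [Finset.mem_filter, mem_dominantCells]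
  constructor
  · rintro ⟨⟨hW, hdom⟩, hUW⟩
    obtain ⟨v, hv, rfl⟩ := Finset.exists_eq_insert_iff.2 ⟨hUW, hcard.trans hW.symm⟩
    exact ⟨v, ⟨hv, hdom⟩, rfl⟩
  · rintro ⟨v, ⟨hv, hdom⟩, rfl⟩
    exact ⟨⟨by rw [Finset.card_insert_of_notMem hv, hcard], hdom⟩, Finset.subset_insert _ _⟩

variable [DecidableEq ι]

/-- A dominant set with one element less than there are rankings has exactly two coinciding minima,
and it extends to a larger dominant set only by the best elements of two sets attached to them. -/
theorem IsDominant.exists_insert_iff {r : ι → V → α} (hr : ∀ i, (r i).Injective) {U : Finset V}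
    (hU : IsDominant r U) (hne : U.Nonempty) (hcard : U.card + 1 = Fintype.card ι) :
    ∃ (m : ι → V) (a b : ι), (∀ i, ∀ u ∈ U, r i (m i) ≤ r i u) ∧ a ≠ b ∧
      (∀ v, ∃ i, r i v ≤ r i (m i)) ∧
      ∀ v, (v ∉ U ∧ IsDominant r (insert v U)) ↔ ∃ j, (j = a ∨ j = b) ∧
        (∀ i ≠ j, r i (m i) < r i v) ∧
        ∀ w, (∀ i ≠ j, r i (m i) < r i w) → r j w ≤ r j v := by
  obtain ⟨m, hmU, hm, hsurj⟩ := hU.exists_min hr hne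
  obtain ⟨a, -, b, -, hab, hmab⟩ := Finset.exists_ne_map_eq_of_card_lt_of_maps_to
    (s := Finset.univ) (t := U) (f := m) (by rw [Finset.card_univ]; omega) (fun i _ ↦ hmU i)
  have hdom : ∀ v, ∃ i, r i v ≤ r i (m i) := fun v ↦ (hU v).imp fun i hi ↦ hi _ (hmU i)
  refine ⟨m, a, b, hm, hab, hdom, fun v ↦ ⟨fun ⟨hv, hvU⟩ ↦ ?_, ?_⟩⟩
  · obtain ⟨m', hmU', hm', hsurj'⟩ := hvU.exists_min hr (Finset.insert_nonempty v U)
    have hinj' : Function.Injective m' := by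
      have := Finset.card_image_iff (s := Finset.univ) (f := m')
      rw [Finset.coe_univ, Set.injOn_univ] at this
      apply this.1
      have himg : Finset.univ.image m' = insert v U := by
        ext u
        simp only [Finset.mem_image, Finset.mem_univ, true_and]
        exact ⟨fun ⟨i, hi⟩ ↦ hi ▸ hmU' i, hsurj' u⟩
      rw [himg, Finset.card_insert_of_notMem hv, hcard, Finset.card_univ]
    obtain ⟨j, rfl⟩ := hsurj' v (Finset.mem_insert_self v U)
    have hmm : ∀ i ≠ j, m' i = m i := fun i hi ↦ by
      have h1 : m' i ∈ U := Finset.mem_of_mem_insert_of_ne (hmU' i) fun h ↦ hi (hinj' h)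
      exact hr i ((hm' i _ (Finset.mem_insert_of_mem (hmU i))).antisymm (hm i _ h1))
    refine ⟨j, ?_, fun i hi ↦ ?_, fun w hw ↦ ?_⟩
    · by_contra! h
      exact hab (hinj' (by rw [hmm a h.1.symm, hmm b h.2.symm, hmab]))
    · rw [← hmm i hi]
      exact (hm' i _ (Finset.mem_insert_self _ _)).lt_of_ne fun h ↦ hi (hinj' (hr i h))
    · obtain ⟨i, hi⟩ := hvU w
      rcases eq_or_ne i j with rfl | hij
      · exact hi _ (Finset.mem_insert_self _ _)
      · exact absurd (hi _ (Finset.mem_insert_of_mem (hmU i))) (hw i hij).not_ge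
  · rintro ⟨j, hj, hv, hmax⟩
    constructor
    · intro hvU
      obtain ⟨i, rfl⟩ := hsurj v hvU
      have hij : i = j := by
        by_contra h
        exact lt_irrefl _ (hv i h)
      subst hij
      rcases hj with rfl | rfl
      · exact lt_irrefl _ (hmab ▸ hv b hab.symm)
      · exact lt_irrefl _ (hmab ▸ hv a hab)
    · intro w
      by_cases hw : ∀ i ≠ j, r i (m i) < r i w
      · refine ⟨j, fun u hu ↦ ?_⟩
        rcases Finset.mem_insert.1 hu with rfl | hu
        · exact hmax w hw
        · obtain ⟨i, hi⟩ := hdom v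
          have hij : i = j := by
            by_contra h
            exact (hv i h).not_ge hi
          subst hij
          exact ((hmax w hw).trans hi).trans (hm i u hu)
      · push Not at hw
        obtain ⟨i, hij, hi⟩ := hw
        refine ⟨i, fun u hu ↦ ?_⟩
        rcases Finset.mem_insert.1 hu with rfl | hu
        · exact hi.trans (hv i hij).le
        · exact hi.trans (hm i u hu)

/-- A set of the size of the palette that misses some color has an even number of facets whose
colors are exactly those different from `i`. -/
theorem even_card_facets {c : V → ι} {W : Finset V} (hW : W.card = Fintype.card ι)
    (hc : W.image c ≠ Finset.univ) (i : ι) {s : Finset (Finset V)}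
    (hs : ∀ U, U ∈ s ↔ U ⊆ W ∧ U.card + 1 = Fintype.card ι ∧ U.image c = Finset.univ.erase i) :
    Even s.card := by
  rcases s.eq_empty_or_nonempty with rfl | ⟨U, hUs⟩
  · simp
  obtain ⟨hUW, hUcard, hUc⟩ := (hs U).1 hUs
  obtain ⟨w, hwU, rfl⟩ := Finset.exists_eq_insert_iff.2 ⟨hUW, hUcard.trans hW.symm⟩
  have hinj : Set.InjOn c U := by
    rw [← Finset.card_image_iff, hUc, ← add_left_inj 1,
      Finset.card_erase_add_one (Finset.mem_univ i), Finset.card_univ, hUcard]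
  have hwi : c w ≠ i := by
    rintro rfl
    rw [Finset.image_insert, hUc, Finset.insert_erase (Finset.mem_univ _)] at hc
    exact hc rfl
  obtain ⟨w', hw'U, hw'⟩ : ∃ w' ∈ U, c w' = c w := by
    rw [← Finset.mem_image, hUc]
    simpa using hwi
  have hww' : w ≠ w' := fun h ↦ hwU (h ▸ hw'U)
  have hset : s = {U, (insert w U).erase w'} := by
    ext U'
    rw [hs, Finset.mem_insert, Finset.mem_singleton]
    constructor
    · rintro ⟨hU'W, hU'card, hU'c⟩
      obtain ⟨x, hx, hxU'⟩ := Finset.exists_eq_insert_iff.2 ⟨hU'W, hU'card.trans hW.symm⟩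
      have hU'x : U' = (insert w U).erase x := by rw [← hxU', Finset.erase_insert hx]
      have hxW : x ∈ insert w U := hxU' ▸ Finset.mem_insert_self _ _
      rcases Finset.mem_insert.1 hxW with rfl | hxU
      · exact .inl (by rw [hU'x, Finset.erase_insert hwU])
      · right
        have hcx : c x ∈ U'.image c := by
          rw [hU'c, ← hUc]
          exact Finset.mem_image_of_mem c hxU
        obtain ⟨y, hy, hyx⟩ := Finset.mem_image.1 hcx
        have hyne : y ≠ x := fun h ↦ hx (h ▸ hy)
        rcases Finset.mem_insert.1 (hU'W hy) with rfl | hyU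
        · rw [hU'x, hinj hxU hw'U (hyx.symm.trans hw'.symm)]
        · exact absurd (hinj hyU hxU hyx) hyne
    · rintro (rfl | rfl)
      · exact ⟨hUW, hUcard, hUc⟩
      · have hmem : w' ∈ insert w U := Finset.mem_insert_of_mem hw'U
        refine ⟨Finset.erase_subset _ _, by rw [Finset.card_erase_add_one hmem, hW], ?_⟩
        rw [Finset.erase_insert_of_ne hww', Finset.image_insert, ← hw', ← Finset.image_insert,
          Finset.insert_erase hw'U, hUc]
  rw [hset, Finset.card_pair]
  · exact even_two
  · intro h
    exact Finset.notMem_erase w' (insert w U) (h ▸ hw'U)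

variable [Fintype V] {r : ι → V → α} {e : ι → V}

theorem IsDominant.even_card_dominantCells (hr : ∀ i, (r i).Injective)
    (he_top : ∀ i k, k ≠ i → ∀ v ∉ Set.range e, r i v < r i (e k)) {U : Finset V}
    (hU : IsDominant r U) (hcard : U.card + 1 = Fintype.card ι)
    {u₀ : V} (hu₀ : u₀ ∈ U) (hu₀e : u₀ ∉ Set.range e) :
    Even {W ∈ dominantCells r | U ⊆ W}.card := by
  obtain ⟨m, a, b, hm, hab, hdom, hiff⟩ := hU.exists_insert_iff hr ⟨u₀, hu₀⟩ hcard
  have hmax : ∀ j, ∃ x, (∀ i ≠ j, r i (m i) < r i x) ∧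
      ∀ w, (∀ i ≠ j, r i (m i) < r i w) → r j w ≤ r j x := fun j ↦ by
    classical
    obtain ⟨x, hx, hx'⟩ := Finset.exists_max_image
      {v : V | ∀ i ≠ j, r i (m i) < r i v} (r j) ⟨e j, by
        simp only [Finset.mem_filter, Finset.mem_univ, true_and]
        exact fun i hi ↦ (hm i u₀ hu₀).trans_lt (he_top i j hi.symm u₀ hu₀e)⟩
    simp only [Finset.mem_filter, Finset.mem_univ, true_and] at hx hx'
    exact ⟨x, hx, hx'⟩
  choose x hx hx' using hmax
  have hne : x a ≠ x b := fun h ↦ by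
    obtain ⟨i, hi⟩ := hdom (x a)
    rcases eq_or_ne i a with rfl | hia
    · exact ((h ▸ hx b) i hab).not_ge hi
    · exact (hx a i hia).not_ge hi
  have hxU : ∀ j, (j = a ∨ j = b) → x j ∉ U := fun j hj ↦
    ((hiff (x j)).2 ⟨j, hj, hx j, hx' j⟩).1
  have : {W ∈ dominantCells r | U ⊆ W} = {insert (x a) U, insert (x b) U} := by
    ext W
    rw [mem_dominantCells_filter_subset hcard]
    simp only [hiff, Finset.mem_insert, Finset.mem_singleton]
    constructor
    · rintro ⟨v, ⟨j, hj, hv, hv'⟩, rfl⟩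
      have hvx : v = x j := hr j ((hx' j v hv).antisymm (hv' _ (hx j)))
      rcases hj with rfl | rfl <;> simp [hvx]
    · rintro (rfl | rfl)
      exacts [⟨_, ⟨a, .inl rfl, hx a, hx' a⟩, rfl⟩, ⟨_, ⟨b, .inr rfl, hx b, hx' b⟩, rfl⟩]
  rw [this, Finset.card_pair fun h ↦ hne ((Finset.insert_inj (hxU a (.inl rfl))).1 h)]
  exact even_two

theorem card_dominantCells_image_erase (hr : ∀ i, (r i).Injective) (he : e.Injective)
    (he_bot : ∀ i v, r i (e i) ≤ r i v)
    (he_top : ∀ i k, k ≠ i → ∀ v ∉ Set.range e, r i v < r i (e k))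
    (hne : ∃ v, v ∉ Set.range e) (i : ι) :
    {W ∈ dominantCells r | (Finset.univ.erase i).image e ⊆ W}.card = 1 := by
  have hcard : ((Finset.univ.erase i).image e).card + 1 = Fintype.card ι := by
    rw [Finset.card_image_of_injective _ he, Finset.card_erase_add_one (Finset.mem_univ i),
      Finset.card_univ]
  classical
  obtain ⟨x, hx, hmax⟩ := Finset.exists_max_image {v : V | v ∉ Set.range e} (r i)
    (hne.imp fun v hv ↦ by simpa using hv)
  simp only [Finset.mem_filter, Finset.mem_univ, true_and] at hx hmax
  rw [Finset.card_eq_one]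
  refine ⟨insert x ((Finset.univ.erase i).image e), ?_⟩
  ext W
  rw [mem_dominantCells_filter_subset hcard, Finset.mem_singleton]
  constructor
  · rintro ⟨v, ⟨hv, hdom⟩, rfl⟩
    congr 1
    obtain ⟨k, hk⟩ := hdom x
    have hki : k = i := by
      by_contra hki
      refine hx ⟨k, hr k ((he_bot k x).antisymm (hk _ (Finset.mem_insert_of_mem ?_)))⟩
      exact Finset.mem_image_of_mem e (by simpa using hki)
    subst hki
    have hxv := hk v (Finset.mem_insert_self _ _)
    by_cases hve : v ∈ Set.range e
    · obtain ⟨l, rfl⟩ := hve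
      have hlk : l = k := by
        by_contra hlk
        exact hv (Finset.mem_image_of_mem e (by simpa using hlk))
      subst hlk
      exact absurd ⟨l, hr l ((he_bot l x).antisymm hxv)⟩ hx
    · exact hr k ((hmax v hve).antisymm hxv)
  · rintro rfl
    refine ⟨x, ⟨fun h ↦ ?_, fun v ↦ ?_⟩, rfl⟩
    · obtain ⟨k, -, rfl⟩ := Finset.mem_image.1 h
      exact hx ⟨k, rfl⟩
    · by_cases hv : v ∈ Set.range e
      · obtain ⟨k, rfl⟩ := hv
        exact ⟨k, fun u _ ↦ he_bot k u⟩
      · refine ⟨i, fun u hu ↦ ?_⟩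
        rcases Finset.mem_insert.1 hu with rfl | hu
        · exact hmax v hv
        · obtain ⟨k, hk, rfl⟩ := Finset.mem_image.1 hu
          exact (he_top i k (Finset.ne_of_mem_erase hk) v hv).le

/-- **Scarf's combinatorial theorem**: every coloring admits a dominant set carrying each color
exactly once. -/
theorem exists_isDominant_image_eq_univ [Nonempty ι] {c : V → ι} (hr : ∀ i, (r i).Injective)
    (he_bot : ∀ i v, r i (e i) ≤ r i v)
    (he_top : ∀ i k, k ≠ i → ∀ v ∉ Set.range e, r i v < r i (e k))
    (hne : ∃ v, v ∉ Set.range e) (hc : ∀ i, c (e i) = i) :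
    ∃ W, W.card = Fintype.card ι ∧ IsDominant r W ∧ W.image c = Finset.univ := by
  classical
  obtain ⟨i⟩ := ‹Nonempty ι›
  have he : e.Injective := Function.LeftInverse.injective hc
  let s : Finset (Finset V) :=
    {U | (U.card + 1 = Fintype.card ι ∧ U.image c = Finset.univ.erase i) ∧ IsDominant r U}
  have hmem : ∀ U, U ∈ s ↔ (U.card + 1 = Fintype.card ι ∧ U.image c = Finset.univ.erase i) ∧
      IsDominant r U := by simp [s]
  let U₀ : Finset V := (Finset.univ.erase i).image e
  have hU₀ : {W ∈ dominantCells r | U₀ ⊆ W}.card = 1 :=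
    card_dominantCells_image_erase hr he he_bot he_top hne i
  have hU₀s : U₀ ∈ s := by
    rw [hmem]
    refine ⟨⟨?_, ?_⟩, ?_⟩
    · rw [Finset.card_image_of_injective _ he, Finset.card_erase_add_one (Finset.mem_univ i),
        Finset.card_univ]
    · simp only [U₀, Finset.image_image, Function.comp_def, hc, Finset.image_id']
    · obtain ⟨W, hW⟩ := Finset.card_pos.1 (hU₀.ge)
      rw [Finset.mem_filter, mem_dominantCells] at hW
      exact hW.1.2.mono hW.2
  have hodd : Odd (∑ U ∈ s, {W ∈ dominantCells r | U ⊆ W}.card) := by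
    rw [← Finset.add_sum_erase s _ hU₀s, hU₀, Nat.odd_add]
    refine iff_of_true odd_one (Finset.even_sum _ fun U hU ↦ ?_)
    obtain ⟨hUne, hUs⟩ := Finset.mem_erase.1 hU
    obtain ⟨⟨hUcard, hUc⟩, hUdom⟩ := (hmem U).1 hUs
    by_cases h : ∃ u ∈ U, u ∉ Set.range e
    · obtain ⟨u, huU, hue⟩ := h
      exact hUdom.even_card_dominantCells hr he_top hUcard huU hue
    · push Not at h
      refine absurd ?_ hUne
      have hec : ∀ u ∈ U, e (c u) = u := fun u hu ↦ by
        obtain ⟨k, rfl⟩ := h u hu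
        rw [hc]
      calc U = U.image (e ∘ c) := by
            ext v
            simp only [Finset.mem_image, Function.comp_apply]
            exact ⟨fun hv ↦ ⟨v, hv, hec v hv⟩, fun ⟨u, hu, huv⟩ ↦ huv ▸ (hec u hu).symm ▸ hu⟩
        _ = U₀ := by rw [← Finset.image_image, hUc]
  have hcount : ∑ U ∈ s, {W ∈ dominantCells r | U ⊆ W}.card =
      ∑ W ∈ dominantCells r, {U ∈ s | U ⊆ W}.card := by
    simp only [Finset.card_filter]
    exact Finset.sum_comm
  rw [hcount] at hodd
  by_contra! h
  refine Nat.not_even_iff_odd.2 hodd (Finset.even_sum _ fun W hW ↦ ?_)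
  obtain ⟨hWcard, hWdom⟩ := mem_dominantCells.1 hW
  refine even_card_facets hWcard (h W hWcard hWdom) i fun U ↦ ?_
  rw [Finset.mem_filter, hmem]
  exact ⟨fun h ↦ ⟨h.2, h.1.1⟩, fun h ↦ ⟨⟨h.2, hWdom.mono h.1⟩, h.1⟩⟩

end Scarf

section Brouwer

variable {ι : Type*} [Fintype ι]

/-- For every coloring of the grid points `∑ i, t i = N`, some box with sides `Fintype.card ι` and
lower corner `m` contains a grid point, and contains one of color `j` whenever `m j ≠ 0`. -/
theorem exists_box_forall_color [Nonempty ι] (N : ℕ) (c : (ι → ℕ) → ι) :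
    ∃ m t₀ : ι → ℕ, (∑ i, t₀ i = N ∧ ∀ i, m i ≤ t₀ i ∧ t₀ i ≤ m i + Fintype.card ι) ∧
      ∀ j, m j = 0 ∨
        ∃ t, c t = j ∧ ∑ i, t i = N ∧ ∀ i, m i ≤ t i ∧ t i ≤ m i + Fintype.card ι := by
  classical
  let S := {x : ι → ℕ // x ∈ Finset.piAntidiag Finset.univ N}
  let _ : Fintype S := inferInstanceAs (Fintype (Finset.piAntidiag (Finset.univ : Finset ι) N))
  have hS : ∀ x : ι → ℕ, x ∈ Finset.piAntidiag Finset.univ N ↔ ∑ i, x i = N := by simp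
  let p : ι → S ⊕ ι → ℕ := fun i ↦
    Sum.elim (fun x ↦ x.1 i + 1) (fun k ↦ if k = i then 0 else N + 2)
  let r : ι → S ⊕ ι → ℕ ×ₗ ℕ := fun i v ↦ toLex (p i v, (Fintype.equivFin (S ⊕ ι) v : ℕ))
  have hlt : ∀ i v w, p i v < p i w → r i v < r i w := fun i v w h ↦
    Prod.Lex.toLex_lt_toLex.2 (.inl h)
  have hle : ∀ i v w, r i v ≤ r i w → p i v ≤ p i w := fun i v w h ↦
    Prod.Lex.monotone_fst _ _ h
  have hr : ∀ i, (r i).Injective := fun i v w h ↦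
    (Fintype.equivFin (S ⊕ ι)).injective (Fin.ext (congrArg Prod.snd (toLex.injective h)))
  have he_bot : ∀ i v, r i (Sum.inr i) ≤ r i v := by
    intro i v
    by_cases h : v = Sum.inr i
    · rw [h]
    · refine (hlt i _ _ ?_).le
      rcases v with x | k
      · simp [p]
      · have : k ≠ i := fun hk ↦ h (hk ▸ rfl)
        simp [p, this]
  have he_top : ∀ i k, k ≠ i → ∀ v ∉ Set.range (Sum.inr : ι → S ⊕ ι), r i v < r i (Sum.inr k) := by
    intro i k hk v hv
    rcases v with x | l
    · refine hlt i _ _ ?_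
      have : x.1 i ≤ N := by
        exact (Finset.single_le_sum (fun _ _ ↦ Nat.zero_le _) (Finset.mem_univ i)).trans_eq
          ((hS _).1 x.2)
      simp only [p, Sum.elim_inl, Sum.elim_inr, if_neg hk]
      omega
    · exact absurd ⟨l, rfl⟩ hv
  obtain ⟨i₀⟩ := ‹Nonempty ι›
  have hx₀ : ∑ i, (Pi.single i₀ N : ι → ℕ) i = N := by simp
  obtain ⟨W, hWcard, hWdom, hWc⟩ := exists_isDominant_image_eq_univ (r := r) (e := Sum.inr)
    (c := Sum.elim (fun x ↦ c x.1) id) hr he_bot he_top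
    ⟨Sum.inl ⟨_, (hS _).2 hx₀⟩, by simp⟩ (fun _ ↦ rfl)
  have hT : ∃ t : S, Sum.inl t ∈ W := by
    by_contra! h
    have hW : ∀ k, Sum.inr k ∈ W := fun k ↦ by
      obtain ⟨v, hv, hvk⟩ := Finset.mem_image.1 (hWc.symm ▸ Finset.mem_univ k)
      rcases v with x | l
      · exact absurd hv (h x)
      · exact (show l = k from hvk) ▸ hv
    obtain ⟨i, hi⟩ := hWdom (Sum.inl ⟨_, (hS _).2 hx₀⟩)
    have := hle _ _ _ (hi _ (hW i))
    simp [p] at this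
  have hm : ∀ i, ∃ n : ℕ, (∀ t : S, Sum.inl t ∈ W → n ≤ t.1 i) ∧
      ((Sum.inr i ∈ W ∧ n = 0) ∨ Sum.inr i ∉ W ∧ ∃ t : S, Sum.inl t ∈ W ∧ t.1 i = n) := fun i ↦ by
    by_cases hi : Sum.inr i ∈ W
    · exact ⟨0, fun _ _ ↦ Nat.zero_le _, .inl ⟨hi, rfl⟩⟩
    · obtain ⟨t, ht, hmin⟩ := Finset.exists_min_image {t : S | Sum.inl t ∈ W} (fun t ↦ t.1 i)
        (hT.imp fun t ht ↦ by simpa using ht)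
      simp only [Finset.mem_filter, Finset.mem_univ, true_and] at ht hmin
      exact ⟨t.1 i, hmin, .inr ⟨hi, t, ht, rfl⟩⟩
  choose m hm_le hm_cases using hm
  have hsum : N < ∑ i, m i + Fintype.card ι := by
    by_contra! h
    have hN : ∑ i, (m i + 1) ≤ N := by simpa [Finset.sum_add_distrib] using h
    let x : ι → ℕ := fun i ↦ m i + 1 + (Pi.single i₀ (N - ∑ i, (m i + 1)) : ι → ℕ) i
    have hx : ∑ i, x i = N := by
      simp only [x]
      rw [Finset.sum_add_distrib, Finset.sum_pi_single']
      simp only [Finset.mem_univ, if_true]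
      omega
    obtain ⟨i, hi⟩ := hWdom (Sum.inl ⟨x, (hS x).2 hx⟩)
    rcases hm_cases i with ⟨hiW, -⟩ | ⟨-, t, htW, ht⟩
    · have := hle _ _ _ (hi _ hiW)
      simp [p] at this
    · have := hle _ _ _ (hi _ htW)
      simp only [p, Sum.elim_inl, x, ht] at this
      omega
  have hbox : ∀ t : S, Sum.inl t ∈ W →
      ∑ i, t.1 i = N ∧ ∀ i, m i ≤ t.1 i ∧ t.1 i ≤ m i + Fintype.card ι := by
    intro t ht
    have htN := (hS _).1 t.2
    refine ⟨htN, fun i ↦ ⟨hm_le i t ht, ?_⟩⟩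
    have h1 : ∑ j ∈ Finset.univ.erase i, m j ≤ ∑ j ∈ Finset.univ.erase i, t.1 j :=
      Finset.sum_le_sum fun j _ ↦ hm_le j t ht
    have h2 := Finset.add_sum_erase Finset.univ m (Finset.mem_univ i)
    have h3 := Finset.add_sum_erase Finset.univ t.1 (Finset.mem_univ i)
    omega
  obtain ⟨t₀, ht₀⟩ := hT
  refine ⟨m, t₀.1, hbox t₀ ht₀, fun j ↦ ?_⟩
  obtain ⟨v, hv, hvj⟩ := Finset.mem_image.1 (hWc.symm ▸ Finset.mem_univ j)
  rcases v with t | l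
  · exact .inr ⟨t.1, hvj, hbox t hv⟩
  · obtain rfl : l = j := hvj
    exact .inl ((hm_cases l).resolve_right fun h ↦ h.1 hv).2

/-- A continuous self-map of the standard simplex almost fixes some point. -/
theorem exists_forall_le_add_of_continuousOn_stdSimplex [Nonempty ι] {h : (ι → ℝ) → ι → ℝ}
    (hcont : ContinuousOn h (stdSimplex ℝ ι))
    (hmaps : Set.MapsTo h (stdSimplex ℝ ι) (stdSimplex ℝ ι)) {ε : ℝ} (hε : 0 < ε) :
    ∃ x ∈ stdSimplex ℝ ι, ∀ i, x i ≤ h x i + ε := by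
  have huc := (isCompact_stdSimplex ℝ ι).uniformContinuousOn_of_continuous hcont
  obtain ⟨δ, hδ, hδh⟩ := Metric.uniformContinuousOn_iff_le.1 huc (ε / 2) (half_pos hε)
  obtain ⟨N, hN⟩ := exists_nat_gt (Fintype.card ι / min δ (ε / 2))
  have hmin : 0 < min δ (ε / 2) := lt_min hδ (half_pos hε)
  have hN0 : (0 : ℝ) < N := (by positivity : (0 : ℝ) ≤ _).trans_lt hN
  have hmesh : Fintype.card ι / (N : ℝ) ≤ min δ (ε / 2) := by
    rw [div_lt_iff₀ hmin] at hN
    rw [div_le_iff₀ hN0]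
    linarith
  let q : (ι → ℕ) → ι → ℝ := fun t i ↦ t i / N
  have hq : ∀ t : ι → ℕ, ∑ i, t i = N → q t ∈ stdSimplex ℝ ι := fun t ht ↦ by
    refine ⟨fun i ↦ by positivity, ?_⟩
    simp only [q]
    rw [← Finset.sum_div, ← Nat.cast_sum, ht, div_self hN0.ne']
  have hcolor : ∀ t : ι → ℕ, ∃ i, ∑ i, t i = N → q t i ≤ h (q t) i := fun t ↦ by
    by_cases ht : ∑ i, t i = N
    · by_contra! hlt
      have := Finset.sum_lt_sum_of_nonempty Finset.univ_nonempty fun i _ ↦ (hlt i).2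
      rw [(hq t ht).2, (hmaps (hq t ht)).2] at this
      exact lt_irrefl _ this
    · exact ⟨Classical.arbitrary ι, fun h ↦ absurd h ht⟩
  choose c hc using hcolor
  obtain ⟨m, t₀, ⟨ht₀, hbox₀⟩, hm⟩ := exists_box_forall_color N c
  refine ⟨q t₀, hq t₀ ht₀, fun j ↦ ?_⟩
  have hclose : ∀ s t : ι → ℕ, (∀ i, m i ≤ s i) → (∀ i, t i ≤ m i + Fintype.card ι) →
      ∀ i, q t i ≤ q s i + min δ (ε / 2) := fun s t hs ht i ↦ by
    have h1 : (t i : ℝ) ≤ s i + Fintype.card ι := by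
      exact_mod_cast (ht i).trans (Nat.add_le_add_right (hs i) _)
    calc q t i ≤ (s i + Fintype.card ι) / N := by simp only [q]; gcongr
      _ = q s i + Fintype.card ι / N := add_div _ _ _
      _ ≤ _ := by gcongr
  rcases hm j with hj | ⟨t, rfl, ht, hbox⟩
  · have h2 : q t₀ j ≤ Fintype.card ι / N := by
      simp only [q]
      gcongr
      simpa [hj] using (hbox₀ j).2
    have h3 := (hmaps (hq t₀ ht₀)).1 j
    have h4 := min_le_right δ (ε / 2)
    linarith
  · have h1 := hclose t t₀ (fun i ↦ (hbox i).1) (fun i ↦ (hbox₀ i).2)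
    have h2 := hclose t₀ t (fun i ↦ (hbox₀ i).1) (fun i ↦ (hbox i).2)
    have hdist : dist (q t) (q t₀) ≤ δ := by
      refine (dist_pi_le_iff hδ.le).2 fun i ↦ ?_
      rw [Real.dist_eq, abs_le]
      have := h1 i
      have := h2 i
      have := min_le_left δ (ε / 2)
      constructor <;> linarith
    have h3 := (dist_le_pi_dist _ _ (c t)).trans (hδh _ (hq t ht) _ (hq t₀ ht₀) hdist)
    rw [Real.dist_eq, abs_le] at h3
    have h4 := hc t ht
    have h5 := h1 (c t)
    have h6 := min_le_right δ (ε / 2)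
    linarith [h3.2]

/-- **Brouwer's fixed-point theorem** for the standard simplex. -/
theorem exists_fixedPoint_of_continuousOn_stdSimplex [Nonempty ι] {h : (ι → ℝ) → ι → ℝ}
    (hcont : ContinuousOn h (stdSimplex ℝ ι))
    (hmaps : Set.MapsTo h (stdSimplex ℝ ι) (stdSimplex ℝ ι)) :
    ∃ x ∈ stdSimplex ℝ ι, h x = x := by
  have hne : (stdSimplex ℝ ι).Nonempty :=
    let ⟨x, hx, _⟩ := exists_forall_le_add_of_continuousOn_stdSimplex hcont hmaps one_pos
    ⟨x, hx⟩
  have hgap : ContinuousOn (fun x ↦ ∑ i, max (x i - h x i) 0) (stdSimplex ℝ ι) := by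
    have := continuousOn_pi.1 hcont
    fun_prop
  obtain ⟨x, hx, hmin⟩ := (isCompact_stdSimplex ℝ ι).exists_isMinOn hne hgap
  have hle : ∀ i, x i ≤ h x i := by
    by_contra! hlt
    obtain ⟨i, hi⟩ := hlt
    have hpos : 0 < ∑ i, max (x i - h x i) 0 :=
      Finset.sum_pos' (fun _ _ ↦ le_max_right _ _)
        ⟨i, Finset.mem_univ i, lt_max_of_lt_left (sub_pos.2 hi)⟩
    have hcard : (0 : ℝ) < Fintype.card ι := by exact_mod_cast Fintype.card_pos
    obtain ⟨y, hy, hyε⟩ := exists_forall_le_add_of_continuousOn_stdSimplex hcont hmaps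
      (half_pos (div_pos hpos hcard))
    have h1 : ∑ i, max (y i - h y i) 0 ≤
        ∑ _i : ι, (∑ i, max (x i - h x i) 0) / Fintype.card ι / 2 :=
      Finset.sum_le_sum fun i _ ↦ max_le (by linarith [hyε i]) (by positivity)
    rw [Finset.sum_const, Finset.card_univ, nsmul_eq_mul] at h1
    have h2 : (Fintype.card ι : ℝ) * ((∑ i, max (x i - h x i) 0) / Fintype.card ι / 2) =
        (∑ i, max (x i - h x i) 0) / 2 := by field_simp
    have h3 : ∑ i, max (x i - h x i) 0 ≤ ∑ i, max (y i - h y i) 0 := hmin hy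
    linarith
  refine ⟨x, hx, funext fun i ↦ ?_⟩
  have heq : ∑ i, x i = ∑ i, h x i := by rw [hx.2, (hmaps hx).2]
  exact ((Finset.sum_eq_sum_iff_of_le fun i _ ↦ hle i).1 heq i (Finset.mem_univ i)).symm

end Brouwer

section Schauder

open Filter Topology

variable {P : Type*} [NormedAddCommGroup P] [NormedSpace ℝ P]

/-- A continuous self-map of a convex set with values in a compact subset of it almost fixes some
point. -/
theorem Convex.exists_norm_sub_le_of_mapsTo_isCompact {D C : Set P} (hD : Convex ℝ D)
    (hne : D.Nonempty) (hC : IsCompact C) (hCD : C ⊆ D) {T : P → P} (hT : ContinuousOn T D)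
    (hmaps : Set.MapsTo T D C) {ε : ℝ} (hε : 0 < ε) : ∃ z ∈ D, ‖T z - z‖ ≤ ε := by
  obtain ⟨t, htC, htfin, htcover⟩ := hC.finite_cover_balls hε
  have := htfin.fintype
  obtain ⟨z₀, hz₀⟩ := hne
  have hcover : ∀ y ∈ C, ∃ c : t, ‖y - c‖ < ε := fun y hy ↦ by
    obtain ⟨c, hct, hc⟩ := Set.mem_iUnion₂.1 (htcover hy)
    exact ⟨⟨c, hct⟩, mem_ball_iff_norm.1 hc⟩
  have : Nonempty t := ⟨(hcover _ (hmaps hz₀)).choose⟩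
  let l : P → t → ℝ := fun y c ↦ max (ε - ‖y - c‖) 0
  have hl0 : ∀ y c, 0 ≤ l y c := fun _ _ ↦ le_max_right _ _
  have hl : Continuous l := by fun_prop
  have hlsum : ∀ y ∈ C, 0 < ∑ c, l y c := fun y hy ↦ by
    obtain ⟨c, hc⟩ := hcover y hy
    exact Finset.sum_pos' (fun c _ ↦ hl0 y c)
      ⟨c, Finset.mem_univ c, lt_max_of_lt_left (sub_pos.2 hc)⟩
  let comb : (t → ℝ) → P := fun w ↦ ∑ c, w c • (c : P)
  have hcomb : Continuous comb := by fun_prop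
  have hcombD : Set.MapsTo comb (stdSimplex ℝ t) D := fun w hw ↦
    hD.sum_mem (fun c _ ↦ hw.1 c) hw.2 fun c _ ↦ hCD (htC c.2)
  have hTcomb : ContinuousOn (fun w ↦ T (comb w)) (stdSimplex ℝ t) :=
    hT.comp hcomb.continuousOn hcombD
  have hlT : ContinuousOn (fun w ↦ l (T (comb w))) (stdSimplex ℝ t) :=
    hl.comp_continuousOn hTcomb
  let h : (t → ℝ) → t → ℝ := fun w c ↦ l (T (comb w)) c / ∑ c, l (T (comb w)) c
  have hsimplex : Set.MapsTo h (stdSimplex ℝ t) (stdSimplex ℝ t) := fun w hw ↦ by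
    have hpos := hlsum _ (hmaps (hcombD hw))
    refine ⟨fun c ↦ div_nonneg (hl0 _ _) hpos.le, ?_⟩
    simp only [h]
    rw [← Finset.sum_div, div_self hpos.ne']
  have hcont : ContinuousOn h (stdSimplex ℝ t) := by
    have hlc := continuousOn_pi.1 hlT
    refine continuousOn_pi.2 fun c ↦ (hlc c).div (continuousOn_finsetSum _ fun c _ ↦ hlc c)
      fun w hw ↦ (hlsum _ (hmaps (hcombD hw))).ne'
  obtain ⟨w, hw, hfix⟩ := exists_fixedPoint_of_continuousOn_stdSimplex hcont hsimplex
  refine ⟨comb w, hcombD hw, ?_⟩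
  have hsub : T (comb w) - comb w = ∑ c, w c • (T (comb w) - (c : P)) := by
    simp only [smul_sub, Finset.sum_sub_distrib, ← Finset.sum_smul, hw.2, one_smul]
    rfl
  calc ‖T (comb w) - comb w‖ ≤ ∑ c, ‖w c • (T (comb w) - (c : P))‖ := by
        rw [hsub]
        exact norm_sum_le _ _
    _ ≤ ∑ c, w c * ε := Finset.sum_le_sum fun c _ ↦ by
        rw [norm_smul, Real.norm_of_nonneg (hw.1 c)]
        rcases le_or_gt ‖T (comb w) - (c : P)‖ ε with hc | hc
        · exact mul_le_mul_of_nonneg_left hc (hw.1 c)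
        · have : w c = 0 := by
            rw [← hfix]
            simp only [h, l]
            rw [max_eq_right (sub_nonpos.2 hc.le), zero_div]
          simp [this]
    _ = ε := by rw [← Finset.sum_mul, hw.2, one_mul]

/-- **Schauder's fixed-point theorem**: a continuous self-map of a convex set with values in a
compact subset of it has a fixed point. -/
theorem Convex.exists_fixedPoint_of_mapsTo_isCompact {D C : Set P} (hD : Convex ℝ D)
    (hne : D.Nonempty) (hC : IsCompact C) (hCD : C ⊆ D) {T : P → P} (hT : ContinuousOn T D)
    (hmaps : Set.MapsTo T D C) : ∃ z ∈ D, T z = z := by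
  choose z hzD hz using fun n : ℕ ↦ hD.exists_norm_sub_le_of_mapsTo_isCompact hne hC hCD hT hmaps
    (Nat.one_div_pos_of_nat (α := ℝ) (n := n))
  obtain ⟨a, haC, φ, hφ, ha⟩ := hC.tendsto_subseq fun n ↦ hmaps (hzD n)
  have hdiff : Tendsto (fun n ↦ T (z n) - z n) atTop (𝓝 0) :=
    squeeze_zero_norm hz tendsto_one_div_add_atTop_nhds_zero_nat
  have hza : Tendsto (z ∘ φ) atTop (𝓝 a) := by
    simpa [Function.comp_def] using ha.sub (hdiff.comp hφ.tendsto_atTop)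
  have hTa : Tendsto (T ∘ z ∘ φ) atTop (𝓝 (T a)) :=
    (hT a (hCD haC)).tendsto.comp
      (tendsto_nhdsWithin_iff.2 ⟨hza, Eventually.of_forall fun n ↦ hzD (φ n)⟩)
  exact ⟨a, hCD haC, tendsto_nhds_unique hTa ha⟩

end Schauder

section UniformContraction

open Filter Topology

variable {P Q : Type*} [NormedAddCommGroup P] [TopologicalSpace Q]

theorem IsComplete.exists_fixedPoint_of_norm_sub_le {D : Set P} (hD : IsComplete D)
    (hne : D.Nonempty) {f : P → P} (hmaps : Set.MapsTo f D D) {k : ℝ} (hk0 : 0 ≤ k) (hk1 : k < 1)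
    (hlip : ∀ x₁ ∈ D, ∀ x₂ ∈ D, ‖f x₁ - f x₂‖ ≤ k * ‖x₁ - x₂‖) : ∃ x ∈ D, f x = x := by
  obtain ⟨x₀, hx₀⟩ := hne
  have hcontr : ContractingWith ⟨k, hk0⟩ (hmaps.restrict f D D) := by
    refine ⟨by exact_mod_cast hk1, LipschitzWith.of_dist_le_mul fun x₁ x₂ ↦ ?_⟩
    rw [Subtype.dist_eq, Subtype.dist_eq, dist_eq_norm, dist_eq_norm]
    exact hlip x₁ x₁.2 x₂ x₂.2
  obtain ⟨x, hx, hfix, -⟩ := hcontr.exists_fixedPoint' hD hmaps hx₀ (edist_ne_top _ _)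
  exact ⟨x, hx, hfix⟩

/-- The fixed point of a uniform contraction depends continuously on the parameter. -/
theorem continuousOn_fixedPoint_of_norm_sub_le {D : Set P} {K : Set Q} {F : P × Q → P}
    (hF : ContinuousOn F (D ×ˢ K)) {k : ℝ} (hk1 : k < 1)
    (hlip : ∀ y ∈ K, ∀ x₁ ∈ D, ∀ x₂ ∈ D, ‖F (x₁, y) - F (x₂, y)‖ ≤ k * ‖x₁ - x₂‖)
    {g : Q → P} (hgD : Set.MapsTo g K D) (hg : ∀ y ∈ K, F (g y, y) = g y) : ContinuousOn g K := by
  intro y₀ hy₀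
  have hFy : ContinuousOn (fun y ↦ F (g y₀, y)) K :=
    hF.comp (by fun_prop) fun y hy ↦ ⟨hgD hy₀, hy⟩
  have hlim : Tendsto (fun y ↦ ‖F (g y₀, y) - g y₀‖ / (1 - k)) (𝓝[K] y₀) (𝓝 0) := by
    have := ((hFy y₀ hy₀).tendsto.sub_const (g y₀)).norm.div_const (1 - k)
    simpa [hg y₀ hy₀] using this
  refine tendsto_iff_norm_sub_tendsto_zero.2 (squeeze_zero' (.of_forall fun _ ↦ norm_nonneg _)
    (eventually_mem_nhdsWithin.mono fun y hy ↦ ?_) hlim)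
  rw [le_div_iff₀ (sub_pos.2 hk1)]
  have h1 := hlip y hy _ (hgD hy) _ (hgD hy₀)
  have h2 := norm_sub_le_norm_sub_add_norm_sub (g y) (F (g y₀, y)) (g y₀)
  rw [hg y hy] at h1
  linarith

end UniformContraction

/-- **Karakostas' fixed-point theorem.**  Let `P` and `Q` be real Banach spaces,
`D ⊆ P` a nonempty closed convex subset, `J : P → Q` continuous on `D` with
`closure (J '' D)` compact, and `F : P × Q → P` continuous on `D ×ˢ closure (J '' D)`,
mapping into `D`, such that the family `x ↦ F (x, y)` (for `y ∈ closure (J '' D)`)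
is equicontractive with constant `k < 1`.  Then `F (z, J z) = z` for some `z ∈ D`. -/
theorem karakostas_fixed_point
    {P Q : Type*} [NormedAddCommGroup P] [NormedSpace ℝ P] [CompleteSpace P]
    [NormedAddCommGroup Q] [NormedSpace ℝ Q] [CompleteSpace Q]
    (D : Set P) (hDne : D.Nonempty) (hDclosed : IsClosed D) (hDconv : Convex ℝ D)
    (J : P → Q) (hJcont : ContinuousOn J D) (hJcomp : IsCompact (closure (J '' D)))
    (F : P × Q → P)
    (hFcont : ContinuousOn F (D ×ˢ closure (J '' D)))
    (hFmaps : ∀ x ∈ D, ∀ y ∈ closure (J '' D), F (x, y) ∈ D)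
    (k : ℝ) (hk0 : 0 ≤ k) (hk1 : k < 1)
    (hFlip : ∀ y ∈ closure (J '' D), ∀ x₁ ∈ D, ∀ x₂ ∈ D,
      ‖F (x₁, y) - F (x₂, y)‖ ≤ k * ‖x₁ - x₂‖) :
    ∃ z ∈ D, F (z, J z) = z := by
  have hmem : ∀ x ∈ D, J x ∈ closure (J '' D) := fun x hx ↦ subset_closure ⟨x, hx, rfl⟩
  have hfix : ∀ y, ∃ x, y ∈ closure (J '' D) → x ∈ D ∧ F (x, y) = x := fun y ↦ by
    by_cases hy : y ∈ closure (J '' D)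
    · exact (hDclosed.isComplete.exists_fixedPoint_of_norm_sub_le hDne
        (fun x hx ↦ hFmaps x hx y hy) hk0 hk1 (hFlip y hy)).imp fun x hx _ ↦ hx
    · exact ⟨0, fun h ↦ absurd h hy⟩
  choose g hg using hfix
  have hgcont : ContinuousOn g (closure (J '' D)) :=
    continuousOn_fixedPoint_of_norm_sub_le hFcont hk1 hFlip
      (fun y hy ↦ (hg y hy).1) fun y hy ↦ (hg y hy).2
  obtain ⟨z, hz, hgz⟩ := hDconv.exists_fixedPoint_of_mapsTo_isCompact hDne
    (hJcomp.image_of_continuousOn hgcont) (Set.image_subset_iff.2 fun y hy ↦ (hg y hy).1)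
    (T := fun x ↦ g (J x)) (hgcont.comp hJcont hmem) fun x hx ↦ ⟨J x, hmem x hx, rfl⟩
  refine ⟨z, hz, ?_⟩
  have := (hg (J z) (hmem z hz)).2
  rwa [hgz] at this
end

section
/- Assume (H1) and (H2) and let J be the operator defined in the context. Then for all bounded functions y, z : [−r,τ] → ℝⁿ such that s ↦ f(s,y_s) and s ↦ f(s,z_s) are Lebesgue integrable on [0,τ], and for every t ∈ [−r,τ], one has ‖J(z)(t) − J(y)(t)‖_{ℝⁿ} ≤ M·(N_q·q + L + τ·K(‖z‖, ‖y‖))·‖z − y‖; in particular J is Lipschitz continuous on every bounded set of such functions (with respect to the supremum norm). -/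
open Matrix MeasureTheory Set Filter

/-- supremum of the norm of `w` over the interval `[a, b]`. -/
noncomputable def supOn {E : Type*} [NormedAddCommGroup E]
    (a b : ℝ) (w : ℝ → E) : ℝ :=
  ⨆ u : Set.Icc a b, ‖w u.1‖

/-- `w` is bounded (in norm) on the interval `[a, b]`. -/
def BddOn {E : Type*} [NormedAddCommGroup E] (a b : ℝ) (w : ℝ → E) : Prop :=
  ∃ C : ℝ, ∀ u ∈ Set.Icc a b, ‖w u‖ ≤ C

lemma norm_le_supOn {E : Type*} [NormedAddCommGroup E] {a b : ℝ} {w : ℝ → E}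
    (hw : BddOn a b w) {u : ℝ} (hu : u ∈ Set.Icc a b) : ‖w u‖ ≤ supOn a b w := by
  obtain ⟨C, hC⟩ := hw
  refine le_ciSup (f := fun u : Set.Icc a b => ‖w u.1‖) ⟨C, ?_⟩ ⟨u, hu⟩
  rintro _ ⟨v, rfl⟩
  exact hC v.1 v.2

lemma supOn_le {E : Type*} [NormedAddCommGroup E] {a b C : ℝ} {w : ℝ → E}
    (hab : a ≤ b) (hC : ∀ u ∈ Set.Icc a b, ‖w u‖ ≤ C) : supOn a b w ≤ C :=
  haveI : Nonempty (Set.Icc a b) := ⟨⟨a, Set.left_mem_Icc.2 hab⟩⟩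
  ciSup_le fun u => hC u.1 u.2

lemma BddOn.sub {E : Type*} [NormedAddCommGroup E] {a b : ℝ} {w₁ w₂ : ℝ → E}
    (h₁ : BddOn a b w₁) (h₂ : BddOn a b w₂) : BddOn a b (w₁ - w₂) := by
  obtain ⟨C₁, h₁⟩ := h₁
  obtain ⟨C₂, h₂⟩ := h₂
  exact ⟨C₁ + C₂, fun u hu => (norm_sub_le _ _).trans (add_le_add (h₁ u hu) (h₂ u hu))⟩

lemma add_mem_Icc_of_history {r τ v w : ℝ} (hv : v ∈ Set.Icc 0 τ)
    (hw : w ∈ Set.Icc (-r) 0) : v + w ∈ Set.Icc (-r) τ :=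
  ⟨by linarith [hv.1, hw.1], by linarith [hv.2, hw.2]⟩

lemma BddOn.history {E : Type*} [NormedAddCommGroup E] {r τ v : ℝ} {y : ℝ → E}
    (hy : BddOn (-r) τ y) (hv : v ∈ Set.Icc 0 τ) : BddOn (-r) 0 (fun w => y (v + w)) := by
  obtain ⟨C, hC⟩ := hy
  exact ⟨C, fun w hw => hC _ (add_mem_Icc_of_history hv hw)⟩

lemma supOn_history_le {E : Type*} [NormedAddCommGroup E] {r τ v : ℝ} {y : ℝ → E} (hr : 0 ≤ r)
    (hy : BddOn (-r) τ y) (hv : v ∈ Set.Icc 0 τ) :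
    supOn (-r) 0 (fun w => y (v + w)) ≤ supOn (-r) τ y :=
  supOn_le (neg_nonpos.2 hr) fun _ hw => norm_le_supOn hy (add_mem_Icc_of_history hv hw)

lemma Continuous.matrix_inv {X : Type*} [TopologicalSpace X] {m : Type*} [Fintype m]
    [DecidableEq m] {B : X → Matrix m m ℝ} (hB : Continuous B) (hinv : ∀ x, IsUnit (B x)) :
    Continuous fun x => (B x)⁻¹ := by
  simp only [Matrix.inv_def, Ring.inverse_eq_inv']
  exact (hB.matrix_det.inv₀ fun x => ((Matrix.isUnit_iff_isUnit_det _).1 (hinv x)).ne_zero).smul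
    hB.matrix_adjugate

lemma IntervalIntegrable.matrix_mulVec {m n : Type*} [Fintype m] [Fintype n]
    {B : ℝ → Matrix m n ℝ} {h : ℝ → n → ℝ} {a b : ℝ}
    (hh : IntervalIntegrable h volume a b) (hB : Continuous B) :
    IntervalIntegrable (fun v => B v *ᵥ h v) volume a b := by
  have hsum : (fun v => B v *ᵥ h v) = fun v => ∑ j, h v j • (fun i => B v i j) := by
    funext v i
    simp [Matrix.mulVec, dotProduct, Finset.sum_apply, mul_comm]
  rw [hsum]
  rw [← Finset.sum_fn]
  refine IntervalIntegrable.sum _ fun j _ => ?_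
  have hj : IntervalIntegrable (fun v => h v j) volume a b :=
    ⟨hh.1.eval j, hh.2.eval j⟩
  exact hj.smul_continuousOn (by fun_prop)

lemma exists_mem_Ioc_succ {t : ℕ → ℝ} {u : ℝ} (h0 : t 0 < u) :
    ∀ m, u ≤ t m → ∃ i < m, u ∈ Set.Ioc (t i) (t (i + 1))
  | 0, h => absurd h0 h.not_gt
  | m + 1, h => by
    by_cases hm : u ≤ t m
    · obtain ⟨i, hi, hu⟩ := exists_mem_Ioc_succ h0 m hm
      exact ⟨i, hi.trans m.lt_succ_self, hu⟩
    · exact ⟨m, m.lt_succ_self, not_le.1 hm, h⟩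

/-- Under (H1) and (H2), the operator `J` is Lipschitz on bounded sets:
`‖J(z)(t) − J(y)(t)‖ ≤ M·(N_q·q + L + τ·K(‖z‖,‖y‖))·‖z − y‖` for all
`t ∈ [−r,τ]`. -/
theorem J_lipschitz_on_bounded_sets
    (n N q : ℕ) (hn : 1 ≤ n)
    (r τ : ℝ) (hr : 0 < r) (hτ : 0 < τ)
    (tt ss : ℕ → ℝ) (htt0 : tt 0 = 0) (hss0 : ss 0 = 0) (htt1 : 0 < tt 1)
    (hts : ∀ i ∈ Finset.Icc 1 N, tt i ≤ ss i ∧ ss i < tt (i + 1))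
    (httN : tt (N + 1) = τ)
    (θ : ℕ → ℝ) (hθ : ∀ j ∈ Finset.Icc 1 q, 0 < θ j ∧ θ j < τ)
    (hθmono : ∀ j ∈ Finset.Icc 1 (q - 1), θ j < θ (j + 1))
    (A : ℝ → Matrix (Fin n) (Fin n) ℝ) (hA : Continuous A)
    (Φ : ℝ → Matrix (Fin n) (Fin n) ℝ)
    (hΦderiv : ∀ t : ℝ, ∀ i j : Fin n,
      HasDerivAt (fun u => Φ u i j) ((A t * Φ t) i j) t)
    (hΦ0 : Φ 0 = 1) (hΦinv : ∀ t, IsUnit (Φ t))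
    (U : ℝ → ℝ → Matrix (Fin n) (Fin n) ℝ)
    (hU : ∀ t s : ℝ, U t s = Φ t * (Φ s)⁻¹)
    (M : ℝ) (hM : 1 ≤ M)
    (hUbd : ∀ t s : ℝ, 0 ≤ s → s ≤ t → t ≤ τ →
      ∀ x : Fin n → ℝ, ‖U t s *ᵥ x‖ ≤ M * ‖x‖)
    -- (H1)
    (Nq L : ℝ) (hNq : 0 < Nq) (hL : 0 < L) (hNqL : L + Nq * (q : ℝ) < 1 / 2)
    (g : (Fin q → ℝ → (Fin n → ℝ)) → ℝ → (Fin n → ℝ))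
    (hg0 : g (fun _ _ => 0) = fun _ => 0)
    (hglip : ∀ y z : Fin q → ℝ → (Fin n → ℝ), ∀ u ∈ Set.Icc (-r) (0 : ℝ),
      ‖g y u - g z u‖ ≤ Nq * ∑ j : Fin q, ‖y j u - z j u‖)
    (G : ℕ → ℝ → (Fin n → ℝ) → (Fin n → ℝ))
    (hG0 : ∀ i ∈ Finset.Icc 1 N, ∀ u : ℝ, G i u 0 = 0)
    (hGlip : ∀ i ∈ Finset.Icc 1 N, ∀ (u : ℝ) (x y : Fin n → ℝ),
      ‖G i u x - G i u y‖ ≤ L * ‖x - y‖)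
    -- (H2)
    (f : ℝ → (ℝ → (Fin n → ℝ)) → (Fin n → ℝ))
    (K : ℝ → ℝ → ℝ) (Ψ : ℝ → ℝ)
    (hKcont : Continuous fun p : ℝ × ℝ => K p.1 p.2)
    (hKmono : ∀ a a' b b' : ℝ, a ≤ a' → b ≤ b' → K a b ≤ K a' b')
    (hKnonneg : ∀ a b : ℝ, 0 ≤ K a b)
    (hΨcont : Continuous Ψ) (hΨmono : Monotone Ψ) (hΨnonneg : ∀ a : ℝ, 0 ≤ Ψ a)
    (hflip : ∀ u ∈ Set.Icc (0 : ℝ) τ, ∀ φ₁ φ₂ : ℝ → (Fin n → ℝ),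
      BddOn (-r) 0 φ₁ → BddOn (-r) 0 φ₂ →
      ‖f u φ₁ - f u φ₂‖ ≤ K (supOn (-r) 0 φ₁) (supOn (-r) 0 φ₂) * supOn (-r) 0 (φ₁ - φ₂))
    (hfbd : ∀ u ∈ Set.Icc (0 : ℝ) τ, ∀ φ' : ℝ → (Fin n → ℝ),
      BddOn (-r) 0 φ' → ‖f u φ'‖ ≤ Ψ (supOn (-r) 0 φ'))
    -- data for J
    (φ : ℝ → (Fin n → ℝ)) (hφ : BddOn (-r) 0 φ) (η : Fin n → ℝ)
    -- the two inputs: bounded functions with integrable superposition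
    (y z : ℝ → (Fin n → ℝ)) (hy : BddOn (-r) τ y) (hz : BddOn (-r) τ z)
    (hfy : IntervalIntegrable (fun u => f u (fun v => y (u + v))) volume 0 τ)
    (hfz : IntervalIntegrable (fun u => f u (fun v => z (u + v))) volume 0 τ)
    -- J(y) and J(z), characterized by the defining piecewise equations
    (Jy Jz : ℝ → (Fin n → ℝ))
    (hJy1 : ∀ u ∈ Set.Ioc (0 : ℝ) (tt 1), Jy u =
      U u 0 *ᵥ (φ 0 - g (fun j w => y (θ (j.1 + 1) + w)) 0)
        + ∫ v in (0 : ℝ)..u, U u v *ᵥ f v (fun w => y (v + w)))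
    (hJy2 : ∀ i ∈ Finset.Icc 1 N, ∀ u ∈ Set.Ioc (ss i) (tt (i + 1)), Jy u =
      U u (ss i) *ᵥ G i (ss i) (y (ss i))
        + ∫ v in (ss i)..u, U u v *ᵥ f v (fun w => y (v + w)))
    (hJy3 : ∀ i ∈ Finset.Icc 1 N, ∀ u ∈ Set.Ioc (tt i) (ss i), Jy u = η)
    (hJy4 : ∀ u ∈ Set.Icc (-r) (0 : ℝ), Jy u = φ u)
    (hJz1 : ∀ u ∈ Set.Ioc (0 : ℝ) (tt 1), Jz u =
      U u 0 *ᵥ (φ 0 - g (fun j w => z (θ (j.1 + 1) + w)) 0)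
        + ∫ v in (0 : ℝ)..u, U u v *ᵥ f v (fun w => z (v + w)))
    (hJz2 : ∀ i ∈ Finset.Icc 1 N, ∀ u ∈ Set.Ioc (ss i) (tt (i + 1)), Jz u =
      U u (ss i) *ᵥ G i (ss i) (z (ss i))
        + ∫ v in (ss i)..u, U u v *ᵥ f v (fun w => z (v + w)))
    (hJz3 : ∀ i ∈ Finset.Icc 1 N, ∀ u ∈ Set.Ioc (tt i) (ss i), Jz u = η)
    (hJz4 : ∀ u ∈ Set.Icc (-r) (0 : ℝ), Jz u = φ u) :
    ∀ u ∈ Set.Icc (-r) τ,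
      ‖Jz u - Jy u‖ ≤
        M * (Nq * (q : ℝ) + L + τ * K (supOn (-r) τ z) (supOn (-r) τ y))
          * supOn (-r) τ (z - y) := by
  set D := supOn (-r) τ (z - y)
  set κ := K (supOn (-r) τ z) (supOn (-r) τ y)
  have hzy : ∀ v ∈ Set.Icc (-r) τ, ‖z v - y v‖ ≤ D := fun v hv =>
    norm_le_supOn (hz.sub hy) hv
  have hD0 : 0 ≤ D := (norm_nonneg _).trans (hzy 0 ⟨by linarith, hτ.le⟩)
  have hκ0 : 0 ≤ κ := hKnonneg _ _
  have hM0 : 0 ≤ M := zero_le_one.trans hM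
  have hΦ : Continuous Φ := continuous_pi fun i => continuous_pi fun j =>
    continuous_iff_continuousAt.2 fun t => (hΦderiv t i j).continuousAt
  have hUcont : ∀ u, Continuous (U u) := fun u => by
    rw [show U u = fun s => Φ u * (Φ s)⁻¹ from funext (hU u)]
    exact continuous_const.matrix_mul (hΦ.matrix_inv hΦinv)
  have hfzy : ∀ v ∈ Set.Icc 0 τ,
      ‖f v (fun w => z (v + w)) - f v (fun w => y (v + w))‖ ≤ κ * D := fun v hv =>
    (hflip v hv _ _ (hz.history hv) (hy.history hv)).trans <|
      mul_le_mul (hKmono _ _ _ _ (supOn_history_le hr.le hz hv) (supOn_history_le hr.le hy hv))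
        (supOn_history_le hr.le (hz.sub hy) hv)
        (Real.iSup_nonneg fun _ => norm_nonneg _) hκ0
  have hint : ∀ a u, 0 ≤ a → a ≤ u → u ≤ τ →
      ‖(∫ v in a..u, U u v *ᵥ f v (fun w => z (v + w))) -
        ∫ v in a..u, U u v *ᵥ f v (fun w => y (v + w))‖ ≤ M * (τ * κ) * D := by
    intro a u ha hau huτ
    have hsub : Set.uIcc a u ⊆ Set.uIcc 0 τ := by
      rw [Set.uIcc_of_le hau, Set.uIcc_of_le hτ.le]
      exact Set.Icc_subset_Icc ha huτ
    rw [← intervalIntegral.integral_sub ((hfz.mono_set hsub).matrix_mulVec (hUcont u))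
      ((hfy.mono_set hsub).matrix_mulVec (hUcont u))]
    calc _ ≤ M * (κ * D) * |u - a| := by
          refine intervalIntegral.norm_integral_le_of_norm_le_const fun v hv => ?_
          rw [Set.uIoc_of_le hau] at hv
          have hv0 : 0 ≤ v := ha.trans hv.1.le
          rw [← Matrix.mulVec_sub]
          exact (hUbd u v hv0 hv.2 huτ _).trans
            (mul_le_mul_of_nonneg_left (hfzy v ⟨hv0, hv.2.trans huτ⟩) hM0)
      _ ≤ M * (κ * D) * τ := by
          refine mul_le_mul_of_nonneg_left ?_ (by positivity)
          rw [abs_of_nonneg (by linarith)]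
          linarith
      _ = M * (τ * κ) * D := by ring
  have hcomb : ∀ a u, 0 ≤ a → a ≤ u → u ≤ τ → ∀ (p p' : Fin n → ℝ) (c : ℝ),
      ‖p - p'‖ ≤ c * D → c ≤ Nq * q + L →
      ‖(U u a *ᵥ p + ∫ v in a..u, U u v *ᵥ f v (fun w => z (v + w))) -
        (U u a *ᵥ p' + ∫ v in a..u, U u v *ᵥ f v (fun w => y (v + w)))‖ ≤
        M * (Nq * q + L + τ * κ) * D := by
    intro a u ha hau huτ p p' c hp hc
    rw [add_sub_add_comm, ← Matrix.mulVec_sub]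
    calc _ ≤ M * ‖p - p'‖ + M * (τ * κ) * D :=
          (norm_add_le _ _).trans (add_le_add (hUbd u a ha hau huτ _) (hint a u ha hau huτ))
      _ ≤ M * ((Nq * q + L) * D) + M * (τ * κ) * D := by
          gcongr
          exact hp.trans (mul_le_mul_of_nonneg_right hc hD0)
      _ = _ := by ring
  have hbound0 : 0 ≤ M * (Nq * q + L + τ * κ) * D := by positivity
  have htt_pos : ∀ i ≤ N, 0 < tt (i + 1) := by
    intro i
    induction i with
    | zero => intro _; exact htt1
    | succ i ih =>
      intro hi
      have h := hts (i + 1) (Finset.mem_Icc.2 (by omega))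
      exact (ih (by omega)).trans (h.1.trans_lt h.2)
  intro u hu
  rcases le_or_gt u 0 with hu0 | hu0
  · rw [hJz4 u ⟨hu.1, hu0⟩, hJy4 u ⟨hu.1, hu0⟩, sub_self, norm_zero]
    exact hbound0
  obtain ⟨i, hi, hui⟩ := exists_mem_Ioc_succ (htt0.trans_lt hu0) (N + 1) (hu.2.trans httN.ge)
  rcases Nat.eq_zero_or_pos i with rfl | hipos
  · rw [htt0] at hui
    rw [hJz1 u hui, hJy1 u hui]
    refine hcomb 0 u le_rfl hui.1.le hu.2 _ _ (Nq * q) ?_ (by linarith)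
    rw [sub_sub_sub_cancel_left, norm_sub_rev]
    refine (hglip _ _ 0 ⟨by linarith, le_rfl⟩).trans ?_
    rw [mul_assoc]
    refine mul_le_mul_of_nonneg_left ?_ hNq.le
    calc _ ≤ ∑ _j : Fin q, D := Finset.sum_le_sum fun j _ => by
          have hj := hθ (j.1 + 1) (Finset.mem_Icc.2 ⟨by omega, j.2⟩)
          exact hzy _ ⟨by linarith, by linarith⟩
      _ = q * D := by simp
  · have hiN : i ∈ Finset.Icc 1 N := Finset.mem_Icc.2 ⟨hipos, by omega⟩
    rcases le_or_gt u (ss i) with hus | hus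
    · rw [hJz3 i hiN u ⟨hui.1, hus⟩, hJy3 i hiN u ⟨hui.1, hus⟩, sub_self, norm_zero]
      exact hbound0
    · rw [hJz2 i hiN u ⟨hus, hui.2⟩, hJy2 i hiN u ⟨hus, hui.2⟩]
      have hs0 : 0 ≤ ss i := by
        have h := htt_pos (i - 1) (by omega)
        rw [Nat.sub_add_cancel hipos] at h
        exact h.le.trans (hts i hiN).1
      refine hcomb (ss i) u hs0 hus.le hu.2 _ _ L ?_ (by nlinarith [q.cast_nonneg (α := ℝ)])
      exact (hGlip i hiN _ _ _).trans
        (mul_le_mul_of_nonneg_left (hzy _ ⟨by linarith, hus.le.trans hu.2⟩) hL.le)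
end

section
/- Assume (H1) and (H2) and let J be the operator defined in the context. Then J maps bounded sets onto bounded sets: for every R > 0, every bounded y : [−r,τ] → ℝⁿ with ‖y‖ ≤ R and s ↦ f(s,y_s) Lebesgue integrable on [0,τ], and every t ∈ [−r,τ], one has ‖J(y)(t)‖_{ℝⁿ} ≤ max{ ‖φ‖, M·(‖φ(0)‖ + N_q·q·R) + M·t₁·Ψ(R), M·L·R + M·τ·Ψ(R), ‖η‖ }. -/
open Matrix MeasureTheory Set Filter

/-- Consecutive comparison `tt i < tt (i + 1)` on `1 ≤ i ≤ N` gives monotonicity on `[1, N + 1]`. -/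
theorem le_of_forall_lt_succ {N : ℕ} {tt : ℕ → ℝ}
    (h : ∀ i ∈ Finset.Icc 1 N, tt i < tt (i + 1)) {i j : ℕ} (hi : 1 ≤ i) (hij : i ≤ j)
    (hj : j ≤ N + 1) : tt i ≤ tt j := by
  induction j, hij using Nat.le_induction with
  | base => exact le_rfl
  | succ k hk ih =>
    exact (ih (by omega)).trans (h k (Finset.mem_Icc.2 ⟨by omega, by omega⟩)).le

/-- The intervals `(0, tt 1]`, `(tt i, ss i]` and `(ss i, tt (i + 1)]` cover `(0, tt (N + 1)]`. -/
theorem mem_Ioc_cases {N : ℕ} {tt ss : ℕ → ℝ} {u : ℝ} (hu0 : 0 < u) (hu : u ≤ tt (N + 1)) :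
    u ∈ Set.Ioc 0 (tt 1) ∨
      (∃ i ∈ Finset.Icc 1 N, u ∈ Set.Ioc (ss i) (tt (i + 1))) ∨
      ∃ i ∈ Finset.Icc 1 N, u ∈ Set.Ioc (tt i) (ss i) := by
  induction N with
  | zero => exact Or.inl ⟨hu0, hu⟩
  | succ k ih =>
    have hmem : k + 1 ∈ Finset.Icc 1 (k + 1) := by simp
    have hsub : Finset.Icc 1 k ⊆ Finset.Icc 1 (k + 1) := Finset.Icc_subset_Icc_right k.le_succ
    rcases le_or_gt u (tt (k + 1)) with h | h
    · rcases ih h with h | ⟨i, hi, h⟩ | ⟨i, hi, h⟩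
      · exact Or.inl h
      · exact Or.inr (Or.inl ⟨i, hsub hi, h⟩)
      · exact Or.inr (Or.inr ⟨i, hsub hi, h⟩)
    · rcases le_or_gt u (ss (k + 1)) with h' | h'
      · exact Or.inr (Or.inr ⟨k + 1, hmem, h, h'⟩)
      · exact Or.inr (Or.inl ⟨k + 1, hmem, h', hu⟩)

/-- Under (H1) and (H2), the operator `J` maps bounded sets onto bounded sets:
if `‖y‖ ≤ R` then `‖J(y)(t)‖ ≤ max { ‖φ‖, M(‖φ(0)‖ + N_q q R) + M t₁ Ψ(R),
M L R + M τ Ψ(R), ‖η‖ }` for all `t ∈ [−r,τ]`. -/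
theorem J_maps_bounded_to_bounded
    (n N q : ℕ) (hn : 1 ≤ n)
    (r τ : ℝ) (hr : 0 < r) (hτ : 0 < τ)
    (tt ss : ℕ → ℝ) (htt0 : tt 0 = 0) (hss0 : ss 0 = 0) (htt1 : 0 < tt 1)
    (hts : ∀ i ∈ Finset.Icc 1 N, tt i ≤ ss i ∧ ss i < tt (i + 1))
    (httN : tt (N + 1) = τ)
    (θ : ℕ → ℝ) (hθ : ∀ j ∈ Finset.Icc 1 q, 0 < θ j ∧ θ j < τ)
    (hθmono : ∀ j ∈ Finset.Icc 1 (q - 1), θ j < θ (j + 1))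
    (A : ℝ → Matrix (Fin n) (Fin n) ℝ) (hA : Continuous A)
    (Φ : ℝ → Matrix (Fin n) (Fin n) ℝ)
    (hΦderiv : ∀ t : ℝ, ∀ i j : Fin n,
      HasDerivAt (fun u => Φ u i j) ((A t * Φ t) i j) t)
    (hΦ0 : Φ 0 = 1) (hΦinv : ∀ t, IsUnit (Φ t))
    (U : ℝ → ℝ → Matrix (Fin n) (Fin n) ℝ)
    (hU : ∀ t s : ℝ, U t s = Φ t * (Φ s)⁻¹)
    (M : ℝ) (hM : 1 ≤ M)
    (hUbd : ∀ t s : ℝ, 0 ≤ s → s ≤ t → t ≤ τ →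
      ∀ x : Fin n → ℝ, ‖U t s *ᵥ x‖ ≤ M * ‖x‖)
    -- (H1)
    (Nq L : ℝ) (hNq : 0 < Nq) (hL : 0 < L) (hNqL : L + Nq * (q : ℝ) < 1 / 2)
    (g : (Fin q → ℝ → (Fin n → ℝ)) → ℝ → (Fin n → ℝ))
    (hg0 : g (fun _ _ => 0) = fun _ => 0)
    (hglip : ∀ y z : Fin q → ℝ → (Fin n → ℝ), ∀ u ∈ Set.Icc (-r) (0 : ℝ),
      ‖g y u - g z u‖ ≤ Nq * ∑ j : Fin q, ‖y j u - z j u‖)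
    (G : ℕ → ℝ → (Fin n → ℝ) → (Fin n → ℝ))
    (hG0 : ∀ i ∈ Finset.Icc 1 N, ∀ u : ℝ, G i u 0 = 0)
    (hGlip : ∀ i ∈ Finset.Icc 1 N, ∀ (u : ℝ) (x y : Fin n → ℝ),
      ‖G i u x - G i u y‖ ≤ L * ‖x - y‖)
    -- (H2)
    (f : ℝ → (ℝ → (Fin n → ℝ)) → (Fin n → ℝ))
    (K : ℝ → ℝ → ℝ) (Ψ : ℝ → ℝ)
    (hKcont : Continuous fun p : ℝ × ℝ => K p.1 p.2)
    (hKmono : ∀ a a' b b' : ℝ, a ≤ a' → b ≤ b' → K a b ≤ K a' b')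
    (hKnonneg : ∀ a b : ℝ, 0 ≤ K a b)
    (hΨcont : Continuous Ψ) (hΨmono : Monotone Ψ) (hΨnonneg : ∀ a : ℝ, 0 ≤ Ψ a)
    (hflip : ∀ u ∈ Set.Icc (0 : ℝ) τ, ∀ φ₁ φ₂ : ℝ → (Fin n → ℝ),
      BddOn (-r) 0 φ₁ → BddOn (-r) 0 φ₂ →
      ‖f u φ₁ - f u φ₂‖ ≤ K (supOn (-r) 0 φ₁) (supOn (-r) 0 φ₂) * supOn (-r) 0 (φ₁ - φ₂))
    (hfbd : ∀ u ∈ Set.Icc (0 : ℝ) τ, ∀ φ' : ℝ → (Fin n → ℝ),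
      BddOn (-r) 0 φ' → ‖f u φ'‖ ≤ Ψ (supOn (-r) 0 φ'))
    -- data for J
    (φ : ℝ → (Fin n → ℝ)) (hφ : BddOn (-r) 0 φ) (η : Fin n → ℝ)
    -- the input: a function bounded by R with integrable superposition
    (R : ℝ) (hR : 0 < R)
    (y : ℝ → (Fin n → ℝ)) (hyR : ∀ u ∈ Set.Icc (-r) τ, ‖y u‖ ≤ R)
    (hfy : IntervalIntegrable (fun u => f u (fun v => y (u + v))) volume 0 τ)
    -- J(y), characterized by the defining piecewise equations
    (Jy : ℝ → (Fin n → ℝ))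
    (hJy1 : ∀ u ∈ Set.Ioc (0 : ℝ) (tt 1), Jy u =
      U u 0 *ᵥ (φ 0 - g (fun j w => y (θ (j.1 + 1) + w)) 0)
        + ∫ v in (0 : ℝ)..u, U u v *ᵥ f v (fun w => y (v + w)))
    (hJy2 : ∀ i ∈ Finset.Icc 1 N, ∀ u ∈ Set.Ioc (ss i) (tt (i + 1)), Jy u =
      U u (ss i) *ᵥ G i (ss i) (y (ss i))
        + ∫ v in (ss i)..u, U u v *ᵥ f v (fun w => y (v + w)))
    (hJy3 : ∀ i ∈ Finset.Icc 1 N, ∀ u ∈ Set.Ioc (tt i) (ss i), Jy u = η)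
    (hJy4 : ∀ u ∈ Set.Icc (-r) (0 : ℝ), Jy u = φ u) :
    ∀ u ∈ Set.Icc (-r) τ,
      ‖Jy u‖ ≤
        max (max (supOn (-r) 0 φ)
              (M * (‖φ 0‖ + Nq * (q : ℝ) * R) + M * tt 1 * Ψ R))
            (max (M * L * R + M * τ * Ψ R) ‖η‖) := by
  have hlt : ∀ i ∈ Finset.Icc 1 N, tt i < tt (i + 1) := fun i hi =>
    (hts i hi).1.trans_lt (hts i hi).2
  have hM0 : 0 ≤ M := zero_le_one.trans hM
  have hΨR : 0 ≤ Ψ R := hΨnonneg R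
  have hfR : ∀ v ∈ Set.Icc (0 : ℝ) τ, ‖f v (fun w => y (v + w))‖ ≤ Ψ R := by
    intro v hv
    have hy : ∀ w ∈ Set.Icc (-r) (0 : ℝ), ‖y (v + w)‖ ≤ R := fun w hw =>
      hyR _ ⟨by linarith [hv.1, hw.1], by linarith [hv.2, hw.2]⟩
    refine (hfbd v hv _ ⟨R, hy⟩).trans (hΨmono ?_)
    exact Real.iSup_le (fun w => hy w.1 w.2) hR.le
  have hint : ∀ s u : ℝ, 0 ≤ s → s ≤ u → u ≤ τ →
      ‖∫ v in s..u, U u v *ᵥ f v (fun w => y (v + w))‖ ≤ M * Ψ R * (u - s) := by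
    intro s u hs hsu hu
    have h := intervalIntegral.norm_integral_le_of_norm_le_const (a := s) (b := u)
      (f := fun v => U u v *ᵥ f v (fun w => y (v + w))) (C := M * Ψ R) (fun v hv => by
        rw [Set.uIoc_of_le hsu] at hv
        have hv0 : 0 ≤ v := hs.trans hv.1.le
        exact (hUbd u v hv0 hv.2 hu _).trans
          (mul_le_mul_of_nonneg_left (hfR v ⟨hv0, hv.2.trans hu⟩) hM0))
    rwa [abs_of_nonneg (sub_nonneg.2 hsu)] at h
  intro u hu
  rcases le_or_gt u 0 with hu0 | hu0
  · have hmem : u ∈ Set.Icc (-r) (0 : ℝ) := ⟨hu.1, hu0⟩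
    rw [hJy4 u hmem]
    obtain ⟨C, hC⟩ := hφ
    have hbdd : BddAbove (Set.range fun v : Set.Icc (-r) (0 : ℝ) => ‖φ v.1‖) :=
      ⟨C, by rintro _ ⟨v, rfl⟩; exact hC v.1 v.2⟩
    exact le_max_of_le_left (le_max_of_le_left (le_ciSup hbdd ⟨u, hmem⟩))
  rcases mem_Ioc_cases (ss := ss) hu0 (hu.2.trans_eq httN.symm) with h | ⟨i, hi, h⟩ | ⟨i, hi, h⟩
  · refine le_max_of_le_left (le_max_of_le_right ?_)
    have hg : ‖g (fun j w => y (θ (j.1 + 1) + w)) 0‖ ≤ Nq * (q : ℝ) * R := by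
      have hlip := hglip (fun j w => y (θ (j.1 + 1) + w)) (fun _ _ => 0) 0 ⟨by linarith, le_rfl⟩
      simp only [hg0, sub_zero, add_zero] at hlip
      have hsum : ∑ j : Fin q, ‖y (θ (j.1 + 1))‖ ≤ (q : ℝ) * R := by
        refine (Finset.sum_le_card_nsmul Finset.univ _ R fun j _ => ?_).trans_eq (by simp)
        have hj := hθ (j.1 + 1) (Finset.mem_Icc.2 ⟨by omega, j.2⟩)
        exact hyR _ ⟨by linarith [hj.1], hj.2.le⟩
      rw [mul_assoc]
      exact hlip.trans (mul_le_mul_of_nonneg_left hsum hNq.le)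
    rw [hJy1 u h]
    refine (norm_add_le _ _).trans (add_le_add ?_ ?_)
    · refine (hUbd u 0 le_rfl hu0.le hu.2 _).trans (mul_le_mul_of_nonneg_left ?_ hM0)
      exact (norm_sub_le _ _).trans (add_le_add_right hg _)
    · refine (hint 0 u le_rfl hu0.le hu.2).trans ?_
      rw [sub_zero, mul_right_comm]
      gcongr
      exact h.2
  · refine le_max_of_le_right (le_max_of_le_left ?_)
    obtain ⟨hi1, hiN⟩ := Finset.mem_Icc.1 hi
    have hs0 : 0 ≤ ss i :=
      (htt1.le.trans (le_of_forall_lt_succ hlt le_rfl hi1 (by omega))).trans (hts i hi).1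
    have hG : ‖G i (ss i) (y (ss i))‖ ≤ L * R := by
      have hlip := hGlip i hi (ss i) (y (ss i)) 0
      rw [hG0 i hi, sub_zero, sub_zero] at hlip
      refine hlip.trans (mul_le_mul_of_nonneg_left (hyR _ ⟨?_, ?_⟩) hL.le)
      · linarith
      · exact h.1.le.trans hu.2
    rw [hJy2 i hi u h]
    refine (norm_add_le _ _).trans (add_le_add ?_ ?_)
    · rw [mul_assoc]
      exact (hUbd u (ss i) hs0 h.1.le hu.2 _).trans (mul_le_mul_of_nonneg_left hG hM0)
    · refine (hint (ss i) u hs0 h.1.le hu.2).trans ?_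
      rw [mul_right_comm]
      gcongr
      linarith [hu.2]
  · rw [hJy3 i hi u h]
    exact le_max_of_le_right (le_max_right _ _)
end
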